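/- arXiv:2409.17664 — 7 statements merged into one kernel-verified Lean document; each statement's English description precedes it below -/
import Mathlib

section
/- Let (T, η, (-)†) be a monad on the category Cont of containers and let c be a right T-comodule structure map on the cointerpretation ⟨⟨-⟩⟩. Then the (T,c)-representable second-order functionals form a subcategory of the category of all second-order functionals: (i) for every container A ◁ P, the identity functional id : (∀ a : A, P a) → (∀ a : A, P a) is represented by the unit η_{A◁P} : (A ◁ P) → T(A ◁ P); (ii) if F : (∀ a : A, P a) → (∀ b : B, Q b) is represented by r_F : (B ◁ Q) → T(A ◁ P) and G : (∀ b : B, Q b) → (∀ c : C, R c) is represented by r_G : (C ◁ R) → T(B ◁ Q), then the composite G ∘ F is represented by the Kleisli composite (r_F)† ∘ r_G : (C ◁ R) → T(A ◁ P). -/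
universe u

/-- A container: a type of shapes together with a family of positions. -/
structure Ctnr : Type (u + 1) where
  A : Type u
  P : A → Type u

/-- A container morphism: a shape map together with a contravariant position map. -/
structure CtnrHom (X Y : Ctnr.{u}) : Type u where
  shape : X.A → Y.A
  pos : ∀ a : X.A, Y.P (shape a) → X.P a

/-- The identity container morphism. -/
def CtnrHom.id (X : Ctnr.{u}) : CtnrHom X X :=
  ⟨fun a => a, fun _ p => p⟩

/-- Composition of container morphisms. -/
def CtnrHom.comp {X Y Z : Ctnr.{u}} (g : CtnrHom Y Z) (f : CtnrHom X Y) : CtnrHom X Z :=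
  ⟨fun a => g.shape (f.shape a), fun a r => f.pos a (g.pos (f.shape a) r)⟩

/-- The cointerpretation of a container (at the unit type). -/
def cosem (X : Ctnr.{u}) : Type u := ∀ a : X.A, X.P a

/-- The contravariant action of the cointerpretation on container morphisms. -/
def cosemMap {X Y : Ctnr.{u}} (h : CtnrHom X Y) : cosem Y → cosem X :=
  fun α a => h.pos a (α (h.shape a))

section
variable (T : Ctnr.{u} → Ctnr.{u})
variable (η : ∀ X : Ctnr.{u}, CtnrHom X (T X))
variable (bind : ∀ {X Y : Ctnr.{u}}, CtnrHom X (T Y) → CtnrHom (T X) (T Y))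
variable (c : ∀ X : Ctnr.{u}, cosem X → cosem (T X))

/-- A second-order functional `F : cosem X → cosem Y` is `(T,c)`-representable if it is
computed by a container morphism `r : Y ⟶ T X` via the comodule structure map `c`. -/
def Representable {X Y : Ctnr.{u}} (F : cosem X → cosem Y) : Prop :=
  ∃ r : CtnrHom Y (T X), ∀ α : cosem X, F α = cosemMap r (c X α)

/-- Comodule-representable second-order functionals form a subcategory of the category
of all second-order functionals: identities are represented by the units of the monad,
and the composite of representable functionals is represented by the Kleisli composite
of their representations. -/
theorem representables_form_subcategory
    -- `(T, η, bind)` is a monad on containers in Kleisli-triple form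
    (bind_eta : ∀ X : Ctnr.{u}, bind (η X) = CtnrHom.id (T X))
    (bind_comp_eta : ∀ {X Y : Ctnr.{u}} (r : CtnrHom X (T Y)),
      (bind r).comp (η X) = r)
    (bind_assoc : ∀ {X Y Z : Ctnr.{u}} (r : CtnrHom X (T Y)) (s : CtnrHom Y (T Z)),
      bind ((bind s).comp r) = (bind s).comp (bind r))
    -- `c` is a right `T`-comodule structure map on the cointerpretation
    (c_natural : ∀ {X Y : Ctnr.{u}} (h : CtnrHom X Y) (α : cosem Y),
      c X (cosemMap h α) = cosemMap (bind ((η Y).comp h)) (c Y α))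
    (c_counit : ∀ (X : Ctnr.{u}) (α : cosem X), cosemMap (η X) (c X α) = α)
    (c_mul : ∀ (X : Ctnr.{u}) (α : cosem X),
      c (T X) (c X α) = cosemMap (bind (CtnrHom.id (T X))) (c X α)) :
    -- (i) the identity functional is represented by the unit
    (∀ X : Ctnr.{u}, ∀ α : cosem X, α = cosemMap (η X) (c X α)) ∧
    -- (ii) composites are represented by Kleisli composites of representations
    (∀ (X Y Z : Ctnr.{u}) (F : cosem X → cosem Y) (G : cosem Y → cosem Z)
        (rF : CtnrHom Y (T X)) (rG : CtnrHom Z (T Y)),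
      (∀ α, F α = cosemMap rF (c X α)) →
      (∀ β, G β = cosemMap rG (c Y β)) →
      (∀ α, G (F α) = cosemMap ((bind rF).comp rG) (c X α))) := by
  refine ⟨fun X α => (c_counit X α).symm, fun X Y Z F G rF rG hF hG α => ?_⟩
  have bind_eq : bind rF = (bind (CtnrHom.id (T X))).comp (bind ((η (T X)).comp rF)) := by
    rw [← bind_assoc]
    change bind rF = bind (((bind (CtnrHom.id (T X))).comp (η (T X))).comp rF)
    rw [bind_comp_eta]
    rfl
  rw [hG, hF, c_natural, c_mul, bind_eq]
  rfl

end
end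

section
/- Let Idᶜ denote the identity container PUnit ◁ (fun _ => PUnit). (i) The cointerpretation ⟨⟨-⟩⟩ is naturally isomorphic to the hom-functor Cont(-, Idᶜ): for every container A ◁ P, container morphisms (A ◁ P) → Idᶜ are in bijection with elements of ∀ a : A, P a, naturally in A ◁ P. (ii) For every monad (T, η, (-)†) on Cont, this correspondence induces a bijection between T-algebra structures α : T(Idᶜ) → Idᶜ on Idᶜ (container morphisms satisfying α ∘ η_{Idᶜ} = id and α ∘ (α ∘ r)† = α ∘ r† for the appropriate instances, equivalently α ∘ η = id and α ∘ T(α) = α ∘ μ) and right T-comodule structure maps c on ⟨⟨-⟩⟩, given by c_{A◁P}(h) = the element of ⟨⟨T(A ◁ P)⟩⟩ corresponding to the container morphism α ∘ T(h̄), where h̄ : (A ◁ P) → Idᶜ corresponds to h. (iii) Under this correspondence, a second-order functional F is (T,c)-representable if and only if there is a container morphism r : (B ◁ Q) → T(A ◁ P) with F equal to the map h ↦ (element corresponding to α ∘ T(h̄) ∘ r). -/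
universe u

/-- The identity container `PUnit ◁ fun _ => PUnit`. -/
def Idc : Ctnr.{u} := ⟨PUnit, fun _ => PUnit⟩

/-- The container morphism `X ⟶ Idc` corresponding to an element of the cointerpretation. -/
def toHom (X : Ctnr.{u}) (h : cosem X) : CtnrHom X Idc :=
  ⟨fun _ => PUnit.unit, fun a _ => h a⟩

/-- The element of the cointerpretation corresponding to a container morphism `X ⟶ Idc`. -/
def fromHom (X : Ctnr.{u}) (u : CtnrHom X Idc) : cosem X :=
  fun a => u.pos a PUnit.unit

section
variable (T : Ctnr.{u} → Ctnr.{u})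
variable (η : ∀ X : Ctnr.{u}, CtnrHom X (T X))
variable (bind : ∀ {X Y : Ctnr.{u}}, CtnrHom X (T Y) → CtnrHom (T X) (T Y))

/-- The functorial action of the monad `T`, `T(u) = (η ∘ u)†`. -/
def TMap {X Y : Ctnr.{u}} (u : CtnrHom X Y) : CtnrHom (T X) (T Y) :=
  bind ((η Y).comp u)

/-- The monad `T`-algebra laws for a structure map `α : T(Idc) ⟶ Idc`,
namely `α ∘ η = id` and `α ∘ T(α) = α ∘ μ` (where `μ = (id)†`). -/
def AlgLaws (α : CtnrHom (T Idc) Idc) : Prop :=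
  α.comp (η Idc) = CtnrHom.id Idc ∧
  α.comp (TMap T η @bind α) = α.comp (bind (CtnrHom.id (T Idc)))

/-- The right `T`-comodule laws for a family `c` of structure maps on the cointerpretation:
naturality, the counit law and the multiplication law. -/
def ComodLaws (c : ∀ X : Ctnr.{u}, cosem X → cosem (T X)) : Prop :=
  (∀ (X Y : Ctnr.{u}) (h : CtnrHom X Y) (α : cosem Y),
    c X (cosemMap h α) = cosemMap (TMap T η @bind h) (c Y α)) ∧
  (∀ (X : Ctnr.{u}) (α : cosem X), cosemMap (η X) (c X α) = α) ∧
  (∀ (X : Ctnr.{u}) (α : cosem X),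
    c (T X) (c X α) = cosemMap (bind (CtnrHom.id (T X))) (c X α))

/-- The comodule structure map on the cointerpretation induced by a `T`-algebra on `Idc`,
via the identification of the cointerpretation with `Ctnr(-, Idc)`:
`c X h` corresponds to `α ∘ T(h̄)`. -/
def correspond (α : CtnrHom (T Idc) Idc) : ∀ X : Ctnr.{u}, cosem X → cosem (T X) :=
  fun X h => fromHom (T X) (α.comp (TMap T η @bind (toHom X h)))

theorem CtnrHom.comp_assoc {W X Y Z : Ctnr.{u}} (h : CtnrHom Y Z) (g : CtnrHom X Y)
    (f : CtnrHom W X) : (h.comp g).comp f = h.comp (g.comp f) :=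
  rfl

theorem TMap_comp
    (bind_comp_eta : ∀ {X Y : Ctnr.{u}} (r : CtnrHom X (T Y)), (bind r).comp (η X) = r)
    (bind_assoc : ∀ {X Y Z : Ctnr.{u}} (r : CtnrHom X (T Y)) (s : CtnrHom Y (T Z)),
      bind ((bind s).comp r) = (bind s).comp (bind r))
    {X Y Z : Ctnr.{u}} (g : CtnrHom Y Z) (f : CtnrHom X Y) :
    TMap T η @bind (g.comp f) = (TMap T η @bind g).comp (TMap T η @bind f) := by
  unfold TMap
  rw [← bind_assoc, ← CtnrHom.comp_assoc (bind _), bind_comp_eta, CtnrHom.comp_assoc]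

/-- Naturality of the multiplication `μ = (id)†`. -/
theorem bind_id_comp_TMap_TMap
    (bind_comp_eta : ∀ {X Y : Ctnr.{u}} (r : CtnrHom X (T Y)), (bind r).comp (η X) = r)
    (bind_assoc : ∀ {X Y Z : Ctnr.{u}} (r : CtnrHom X (T Y)) (s : CtnrHom Y (T Z)),
      bind ((bind s).comp r) = (bind s).comp (bind r))
    {X Y : Ctnr.{u}} (f : CtnrHom X Y) :
    (bind (CtnrHom.id (T Y))).comp (TMap T η @bind (TMap T η @bind f)) =
      (TMap T η @bind f).comp (bind (CtnrHom.id (T X))) := by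
  unfold TMap
  rw [← bind_assoc, ← bind_assoc, ← CtnrHom.comp_assoc, bind_comp_eta]
  rfl

/-- The cointerpretation is representable by the identity container, `T`-algebra structures
on the identity container biject with right `T`-comodule structure maps on the
cointerpretation, and under this correspondence comodule representability agrees with
algebra representability. -/
theorem cointerpretation_representable_and_algebras_biject_with_comodules
    -- `(T, η, bind)` is a monad on containers in Kleisli-triple form
    (bind_eta : ∀ X : Ctnr.{u}, bind (η X) = CtnrHom.id (T X))
    (bind_comp_eta : ∀ {X Y : Ctnr.{u}} (r : CtnrHom X (T Y)),
      (bind r).comp (η X) = r)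
    (bind_assoc : ∀ {X Y Z : Ctnr.{u}} (r : CtnrHom X (T Y)) (s : CtnrHom Y (T Z)),
      bind ((bind s).comp r) = (bind s).comp (bind r)) :
    -- (i) the cointerpretation is naturally isomorphic to `Ctnr(-, Idc)`
    ((∀ (X : Ctnr.{u}) (h : cosem X), fromHom X (toHom X h) = h) ∧
     (∀ (X : Ctnr.{u}) (u : CtnrHom X Idc), toHom X (fromHom X u) = u) ∧
     (∀ (X Y : Ctnr.{u}) (u : CtnrHom X Y) (α : cosem Y),
       toHom X (cosemMap u α) = (toHom Y α).comp u)) ∧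
    -- (ii) this correspondence induces a bijection between `T`-algebra structures on `Idc`
    -- and right `T`-comodule structure maps on the cointerpretation
    ((∀ α : CtnrHom (T Idc) Idc, AlgLaws T η @bind α →
        ComodLaws T η @bind (correspond T η @bind α)) ∧
     (∀ c : ∀ X : Ctnr.{u}, cosem X → cosem (T X), ComodLaws T η @bind c →
        ∃! α : CtnrHom (T Idc) Idc,
          AlgLaws T η @bind α ∧ correspond T η @bind α = c)) ∧
    -- (iii) under the correspondence, comodule representability coincides with
    -- algebra representability
    (∀ α : CtnrHom (T Idc) Idc, AlgLaws T η @bind α →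
      ∀ (X Y : Ctnr.{u}) (F : cosem X → cosem Y),
        (∃ r : CtnrHom Y (T X), ∀ h, F h = cosemMap r (correspond T η @bind α X h)) ↔
        (∃ r : CtnrHom Y (T X), ∀ h,
          F h = fromHom Y ((α.comp (TMap T η @bind (toHom X h))).comp r))) := by
  have map_comp {X Y Z : Ctnr.{u}} (g : CtnrHom Y Z) (f : CtnrHom X Y) :=
    TMap_comp T η @bind @bind_comp_eta @bind_assoc g f
  refine ⟨⟨fun _ _ => rfl, fun _ _ => rfl, fun _ _ _ _ => rfl⟩, ⟨?_, ?_⟩, ?_⟩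
  · rintro α ⟨-, hmul⟩
    refine ⟨fun X Y h β => ?_, fun X β => ?_, fun X β => ?_⟩
    · change fromHom _ (α.comp (TMap T η @bind ((toHom Y β).comp h))) = _
      rw [map_comp]
      rfl
    · change fromHom _ (α.comp ((bind _).comp (η X))) = β
      rw [bind_comp_eta]
      rfl
    · change fromHom _ (α.comp (TMap T η @bind (α.comp (TMap T η @bind (toHom X β))))) =
        fromHom _ (α.comp ((TMap T η @bind (toHom X β)).comp (bind (CtnrHom.id (T X)))))
      rw [map_comp, ← CtnrHom.comp_assoc, hmul, CtnrHom.comp_assoc,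
        bind_id_comp_TMap_TMap T η @bind @bind_comp_eta @bind_assoc]
  · rintro c ⟨hnat, -, hmul⟩
    -- the algebra is the image under `c` of the universal element of `cosem Idc`
    refine ⟨toHom _ (c Idc (fromHom Idc (CtnrHom.id Idc))), ⟨⟨rfl, ?_⟩, ?_⟩, ?_⟩
    · have h := hmul Idc (fromHom Idc (CtnrHom.id Idc))
      have h' := hnat _ _ (toHom _ (c Idc (fromHom Idc (CtnrHom.id Idc))))
        (fromHom Idc (CtnrHom.id Idc))
      exact congrArg (toHom _) (h'.symm.trans h)
    · funext X h
      exact (hnat _ _ (toHom X h) (fromHom Idc (CtnrHom.id Idc))).symm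
    · rintro α ⟨-, rfl⟩
      change α = α.comp (bind (η Idc))
      rw [bind_eta]
      rfl
  · exact fun α _ X Y F => Iff.rfl
end
end

section
/- Let (M, ηᴹ, bindᴹ) be a monad in Kleisli-triple form on Type u, equipped with a weak Mendler-style M-algebra on Type u. Then the data T(A ◁ P) := (M A) ◁ P⋆, unit η_{A◁P} := (ηᴹ_A, fun a => i_P a), and Kleisli extension of (f, g) : (A ◁ P) → T(B ◁ Q) given by (bindᴹ f, fun m => (g)⋆ m ∘ j_{Q,f} m) satisfies the three Kleisli-triple monad laws on the category of containers with shapes and positions in Type u: (η_{A◁P})† = id, (f,g)† ∘ η_{A◁P} = (f,g), and ((k,l)† ∘ (f,g))† = (k,l)† ∘ (f,g)†. -/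
universe u

section
variable (M : Type u → Type u)
variable (ηM : ∀ {A : Type u}, A → M A)
variable (bindM : ∀ {A B : Type u}, (A → M B) → M A → M B)

/-- A weak Mendler-style `M`-algebra on the universe `Type u`, for a monad
`(M, ηM, bindM)` given in Kleisli-triple form (with the monad laws supplied as the
parameters `law_unit_left`, `law_unit_right` and `law_assoc`). -/
structure WeakMendlerAlg
    (law_unit_left : ∀ {A : Type u} (m : M A), bindM (fun a => ηM a) m = m)
    (law_unit_right : ∀ {A B : Type u} (f : A → M B) (a : A), bindM f (ηM a) = f a)
    (law_assoc : ∀ {A B C : Type u} (f : A → M B) (g : B → M C) (m : M A),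
      bindM (fun a => bindM g (f a)) m = bindM g (bindM f m)) :
    Type (u + 1) where
  /-- The extension operation on families. -/
  ext : ∀ {A : Type u}, (A → Type u) → M A → Type u
  /-- The action on family maps. -/
  act : ∀ {A : Type u} {P Q : A → Type u},
    (∀ a, P a → Q a) → ∀ m : M A, ext P m → ext Q m
  /-- The family of maps laxly witnessing the first Mendler-style algebra law. -/
  i : ∀ {A : Type u} (P : A → Type u) (a : A), ext P (ηM a) → P a
  /-- The family of maps laxly witnessing the second Mendler-style algebra law. -/
  j : ∀ {A B : Type u} (Q : B → Type u) (f : A → M B) (m : M A),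
    ext Q (bindM f m) → ext (fun a => ext Q (f a)) m
  /-- The action is functorial: identities. -/
  act_id : ∀ {A : Type u} {P : A → Type u} (m : M A) (x : ext P m),
    act (fun _ p => p) m x = x
  /-- The action is functorial: composition. -/
  act_comp : ∀ {A : Type u} {P Q R : A → Type u}
    (h : ∀ a, P a → Q a) (h' : ∀ a, Q a → R a) (m : M A) (x : ext P m),
    act (fun a p => h' a (h a p)) m x = act h' m (act h m x)
  /-- Naturality of `i` with respect to the action. -/
  i_nat : ∀ {A : Type u} {P P' : A → Type u} (h : ∀ a, P a → P' a) (a : A)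
    (x : ext P (ηM a)), h a (i P a x) = i P' a (act h (ηM a) x)
  /-- Naturality of `j` with respect to the action. -/
  j_nat : ∀ {A B : Type u} {Q Q' : B → Type u} (k : ∀ b, Q b → Q' b)
    (f : A → M B) (m : M A) (x : ext Q (bindM f m)),
    act (fun a => act k (f a)) m (j Q f m x) = j Q' f m (act k (bindM f m) x)
  /-- Coherence of `i` and `j` with the right unit monad law. -/
  coh_unit_right : ∀ {A B : Type u} (Q : B → Type u) (f : A → M B) (a : A)
    (x : ext Q (bindM f (ηM a))),
    i (fun a' => ext Q (f a')) a (j Q f (ηM a) x) =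
      cast (congrArg (ext Q) (law_unit_right f a)) x
  /-- Coherence of `i` and `j` with the left unit monad law. -/
  coh_unit_left : ∀ {A : Type u} (P : A → Type u) (m : M A)
    (x : ext P (bindM (fun a => ηM a) m)),
    act (fun a => i P a) m (j P (fun a => ηM a) m x) =
      cast (congrArg (ext P) (law_unit_left m)) x
  /-- Coherence of `j` with the associativity monad law. -/
  coh_assoc : ∀ {A B C : Type u} (R : C → Type u) (f : A → M B) (g : B → M C)
    (m : M A) (x : ext R (bindM (fun a => bindM g (f a)) m)),
    j (fun b => ext R (g b)) f m
        (j R g (bindM f m) (cast (congrArg (ext R) (law_assoc f g m)) x)) =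
      act (fun a => j R g (f a)) m (j R (fun a => bindM g (f a)) m x)

variable {law_unit_left : ∀ {A : Type u} (m : M A), bindM (fun a => ηM a) m = m}
variable {law_unit_right : ∀ {A B : Type u} (f : A → M B) (a : A), bindM f (ηM a) = f a}
variable {law_assoc : ∀ {A B C : Type u} (f : A → M B) (g : B → M C) (m : M A),
  bindM (fun a => bindM g (f a)) m = bindM g (bindM f m)}
variable (W : WeakMendlerAlg M @ηM @bindM @law_unit_left @law_unit_right @law_assoc)

/-- The object part of the induced monad on containers. -/
def TW (X : Ctnr.{u}) : Ctnr.{u} :=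
  ⟨M X.A, W.ext X.P⟩

/-- The unit of the induced monad on containers. -/
def etaW (X : Ctnr.{u}) : CtnrHom X (TW M @ηM @bindM W X) where
  shape a := ηM a
  pos a := W.i X.P a

/-- The Kleisli extension of the induced monad on containers. -/
def bindW {X Y : Ctnr.{u}} (h : CtnrHom X (TW M @ηM @bindM W Y)) :
    CtnrHom (TW M @ηM @bindM W X) (TW M @ηM @bindM W Y) where
  shape := bindM h.shape
  pos m x := W.act h.pos m (W.j Y.P h.shape m x)

/-- Two container morphisms agree if their shape maps agree pointwise and their position maps
agree up to transport along that agreement. -/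
theorem CtnrHom.eq_of_cast {X Y : Ctnr.{u}} {f g : CtnrHom X Y}
    (hshape : ∀ a, f.shape a = g.shape a)
    (hpos : ∀ a (x : Y.P (f.shape a)),
      f.pos a x = g.pos a (cast (congrArg Y.P (hshape a)) x)) : f = g := by
  obtain ⟨fs, fp⟩ := f
  obtain ⟨gs, gp⟩ := g
  obtain rfl : fs = gs := funext hshape
  obtain rfl : fp = gp := funext fun a => funext fun x => hpos a x
  rfl

/-- A weak Mendler-style `M`-algebra on the universe induces a monad on containers:
the three Kleisli-triple laws hold. -/
theorem weakMendler_gives_monad_on_containers :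
    (∀ X : Ctnr.{u},
      bindW M @ηM @bindM W (etaW M @ηM @bindM W X) = CtnrHom.id (TW M @ηM @bindM W X)) ∧
    (∀ (X Y : Ctnr.{u}) (h : CtnrHom X (TW M @ηM @bindM W Y)),
      (bindW M @ηM @bindM W h).comp (etaW M @ηM @bindM W X) = h) ∧
    (∀ (X Y Z : Ctnr.{u}) (h : CtnrHom X (TW M @ηM @bindM W Y))
        (k : CtnrHom Y (TW M @ηM @bindM W Z)),
      bindW M @ηM @bindM W ((bindW M @ηM @bindM W k).comp h) =
        (bindW M @ηM @bindM W k).comp (bindW M @ηM @bindM W h)) := by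
  refine ⟨fun X => ?_, fun X Y h => ?_, fun X Y Z h k => ?_⟩
  · exact CtnrHom.eq_of_cast law_unit_left fun m x => W.coh_unit_left X.P m x
  · refine CtnrHom.eq_of_cast (law_unit_right h.shape) fun a x => ?_
    exact (W.i_nat h.pos a _).symm.trans
      (congrArg (h.pos a) (W.coh_unit_right Y.P h.shape a x))
  · refine CtnrHom.eq_of_cast (law_assoc h.shape k.shape) fun m x => ?_
    refine (W.act_comp (fun a r => W.act k.pos (h.shape a) (W.j Z.P k.shape (h.shape a) r))
      h.pos m _).trans (congrArg (W.act h.pos m) ?_)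
    refine (W.act_comp (fun a => W.j Z.P k.shape (h.shape a))
      (fun a => W.act k.pos (h.shape a)) m _).trans ?_
    refine (congrArg (W.act (fun a => W.act k.pos (h.shape a)) m)
      (W.coh_assoc Z.P h.shape k.shape m x).symm).trans ?_
    exact W.j_nat k.pos h.shape m _

end
end

section
/- The category PCont of propositional containers is a distributive category: it has a terminal object PUnit ◁ᵖ (fun _ => False), an initial object Empty ◁ᵖ (fun e => False), binary products (A ◁ᵖ P) ×ᵖ (B ◁ᵖ Q) = (A × B) ◁ᵖ (fun (a,b) => P a ∨ Q b) with the evident projections, and binary coproducts (A ◁ᵖ P) +ᵖ (B ◁ᵖ Q) = (A ⊕ B) ◁ᵖ Sum.elim P Q with the evident injections, all satisfying their universal properties; moreover binary products distribute over binary coproducts, i.e., the canonical morphism from (A ◁ᵖ P) ×ᵖ (B ◁ᵖ Q) +ᵖ (A ◁ᵖ P) ×ᵖ (C ◁ᵖ R) to (A ◁ᵖ P) ×ᵖ ((B ◁ᵖ Q) +ᵖ (C ◁ᵖ R)) is an isomorphism. -/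
/-- A propositional container: a type of shapes with a `Prop`-valued family of positions. -/
structure PCtnr : Type 1 where
  A : Type
  P : A → Prop

/-- A morphism of propositional containers: a function on shapes whose graph reverses
the positions. -/
structure PHom (X Y : PCtnr) : Type where
  toFun : X.A → Y.A
  prop : ∀ a : X.A, Y.P (toFun a) → X.P a

/-- The identity morphism of propositional containers. -/
def PHom.id (X : PCtnr) : PHom X X :=
  ⟨fun a => a, fun _ p => p⟩

/-- Composition of morphisms of propositional containers. -/
def PHom.comp {X Y Z : PCtnr} (g : PHom Y Z) (f : PHom X Y) : PHom X Z :=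
  ⟨fun a => g.toFun (f.toFun a), fun a r => f.prop a (g.prop (f.toFun a) r)⟩

/-- The binary product of propositional containers. -/
def pprod (X Y : PCtnr) : PCtnr :=
  ⟨X.A × Y.A, fun z => X.P z.1 ∨ Y.P z.2⟩

/-- The first product projection. -/
def pfst (X Y : PCtnr) : PHom (pprod X Y) X :=
  ⟨Prod.fst, fun _ h => Or.inl h⟩

/-- The second product projection. -/
def psnd (X Y : PCtnr) : PHom (pprod X Y) Y :=
  ⟨Prod.snd, fun _ h => Or.inr h⟩

/-- Pairing of morphisms into a binary product. -/
def ppair {W X Y : PCtnr} (f : PHom W X) (g : PHom W Y) : PHom W (pprod X Y) :=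
  ⟨fun w => (f.toFun w, g.toFun w), fun w h => h.elim (f.prop w) (g.prop w)⟩

/-- The functorial action of the binary product on morphisms. -/
def pprodMap {X X' Y Y' : PCtnr} (f : PHom X X') (g : PHom Y Y') :
    PHom (pprod X Y) (pprod X' Y') :=
  ⟨Prod.map f.toFun g.toFun, fun z h => h.imp (f.prop z.1) (g.prop z.2)⟩

/-- The terminal propositional container. -/
def pOne : PCtnr := ⟨PUnit, fun _ => False⟩

/-- The initial propositional container. -/
def pZero : PCtnr := ⟨Empty, fun _ => False⟩

/-- The binary coproduct of propositional containers. -/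
def psum (X Y : PCtnr) : PCtnr :=
  ⟨X.A ⊕ Y.A, Sum.elim X.P Y.P⟩

/-- The first coproduct injection. -/
def pinl (X Y : PCtnr) : PHom X (psum X Y) :=
  ⟨Sum.inl, fun _ h => h⟩

/-- The second coproduct injection. -/
def pinr (X Y : PCtnr) : PHom Y (psum X Y) :=
  ⟨Sum.inr, fun _ h => h⟩

/-- Copairing of morphisms out of a binary coproduct. -/
def pcopair {X Y W : PCtnr} (f : PHom X W) (g : PHom Y W) : PHom (psum X Y) W where
  toFun := Sum.elim f.toFun g.toFun
  prop z := match z with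
    | .inl a => f.prop a
    | .inr b => g.prop b

/-- The canonical distributivity morphism. -/
def pdistrib (X Y Z : PCtnr) :
    PHom (psum (pprod X Y) (pprod X Z)) (pprod X (psum Y Z)) where
  toFun := Sum.elim (fun p => (p.1, Sum.inl p.2)) (fun p => (p.1, Sum.inr p.2))
  prop z := match z with
    | .inl _ => fun h => h
    | .inr _ => fun h => h

/-- Morphisms of propositional containers are determined by their action on shapes. -/
theorem PHom.ext_toFun {X Y : PCtnr} {f g : PHom X Y} (h : ∀ a, f.toFun a = g.toFun a) :
    f = g := by
  cases f
  cases g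
  congr
  exact funext h

/-- The inverse of the canonical distributivity morphism. -/
def pdistribInv (X Y Z : PCtnr) :
    PHom (pprod X (psum Y Z)) (psum (pprod X Y) (pprod X Z)) where
  toFun p := match p with
    | (x, .inl y) => .inl (x, y)
    | (x, .inr z) => .inr (x, z)
  prop p := match p with
    | (_, .inl _) => fun h => h
    | (_, .inr _) => fun h => h

/-- The category of propositional containers is distributive: it has a terminal object,
an initial object, binary products and binary coproducts, and products distribute over
coproducts. -/
theorem PCtnr_distributive :
    -- terminal object
    (∀ X : PCtnr, ∃ f : PHom X pOne, ∀ g : PHom X pOne, g = f) ∧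
    -- initial object
    (∀ X : PCtnr, ∃ f : PHom pZero X, ∀ g : PHom pZero X, g = f) ∧
    -- binary products, with the evident projections
    (∀ (X Y W : PCtnr) (f : PHom W X) (g : PHom W Y),
      ∃! h : PHom W (pprod X Y),
        (pfst X Y).comp h = f ∧ (psnd X Y).comp h = g) ∧
    -- binary coproducts, with the evident injections
    (∀ (X Y W : PCtnr) (f : PHom X W) (g : PHom Y W),
      ∃! h : PHom (psum X Y) W,
        h.comp (pinl X Y) = f ∧ h.comp (pinr X Y) = g) ∧
    -- binary products distribute over binary coproducts
    (∀ X Y Z : PCtnr,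
      ∃ e : PHom (pprod X (psum Y Z)) (psum (pprod X Y) (pprod X Z)),
        e.comp (pdistrib X Y Z) = PHom.id (psum (pprod X Y) (pprod X Z)) ∧
        (pdistrib X Y Z).comp e = PHom.id (pprod X (psum Y Z))) := by
  refine ⟨fun X => ⟨⟨fun _ => PUnit.unit, fun _ h => h.elim⟩, fun g => PHom.ext_toFun fun _ => rfl⟩,
    fun X => ⟨⟨fun e => e.elim, fun e => e.elim⟩, fun g => PHom.ext_toFun fun e => e.elim⟩,
    fun X Y W f g => ⟨ppair f g, ⟨rfl, rfl⟩, ?_⟩,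
    fun X Y W f g => ⟨pcopair f g, ⟨rfl, rfl⟩, ?_⟩,
    fun X Y Z => ⟨pdistribInv X Y Z, PHom.ext_toFun ?_, PHom.ext_toFun ?_⟩⟩
  · rintro h ⟨rfl, rfl⟩
    rfl
  · rintro h ⟨rfl, rfl⟩
    refine PHom.ext_toFun ?_
    rintro (a | b) <;> rfl
  · rintro (⟨x, y⟩ | ⟨x, z⟩) <;> rfl
  · rintro ⟨x, y | z⟩ <;> rfl
end

section
/- The category PCont of propositional containers has weak exponentials: for propositional containers A ◁ᵖ P and B ◁ᵖ Q, define E := {(k, K) : (A → B) × Prop // ∀ a : A, Q (k a) → P a ∨ K} and W : E → Prop by W (k, K) = ∃ a : A, Q (k a) ∧ K. Then: (i) ev : E × A → B, ev ((k,K), a) = k a, is a morphism (E ◁ᵖ W) ×ᵖ (A ◁ᵖ P) → (B ◁ᵖ Q) in PCont; (ii) for every morphism f : (C ◁ᵖ R) ×ᵖ (A ◁ᵖ P) → (B ◁ᵖ Q), the map curry f : C → E, curry f c = ((fun a => f (c, a)), R c), is a morphism (C ◁ᵖ R) → (E ◁ᵖ W) in PCont and satisfies ev ∘ (curry f ×ᵖ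 id) = f. -/
section
variable (X Y : PCtnr)

/-- The shapes of the weak exponential of propositional containers `X` and `Y`. -/
def wexpShape : Type :=
  {kK : (X.A → Y.A) × Prop // ∀ a : X.A, Y.P (kK.1 a) → X.P a ∨ kK.2}

/-- The weak exponential of propositional containers `X` and `Y`. -/
def wexp : PCtnr :=
  ⟨wexpShape X Y, fun kK => ∃ a : X.A, Y.P (kK.val.1 a) ∧ kK.val.2⟩

/-- The evaluation morphism of the weak exponential. -/
def wev : PHom (pprod (wexp X Y) X) Y where
  toFun z := z.1.val.1 z.2
  prop z h := by
    rcases z with ⟨⟨⟨k, K⟩, hk⟩, a⟩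
    rcases hk a h with hP | hK
    · exact Or.inr hP
    · exact Or.inl ⟨a, h, hK⟩

variable {X Y}

/-- Weak currying of a morphism `(C ×ᵖ X) → Y` through the weak exponential. -/
def wcurry {C : PCtnr} (f : PHom (pprod C X) Y) : PHom C (wexp X Y) where
  toFun c := ⟨((fun a => f.toFun (c, a)), C.P c), fun a h => (f.prop (c, a) h).symm⟩
  prop c h := by
    rcases h with ⟨a, _, hK⟩
    exact hK

end

/-- The category of propositional containers has weak exponentials: evaluation is given
by function application, weak currying is as described, and the evaluation triangle
commutes (without any uniqueness requirement on the currying). -/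
theorem PCtnr_weak_exponentials :
    ∀ (X Y : PCtnr),
      -- the evaluation morphism is given by application
      (wev X Y).toFun = (fun z => z.1.val.1 z.2) ∧
      ∀ (C : PCtnr) (f : PHom (pprod C X) Y),
        -- weak currying is given by the stated formula
        (fun c => ((wcurry f).toFun c).val) = (fun c => ((fun a => f.toFun (c, a)), C.P c)) ∧
        -- the evaluation triangle commutes
        (wev X Y).comp (pprodMap (wcurry f) (PHom.id X)) = f := by
  exact fun _ _ => ⟨rfl, fun _ _ => ⟨rfl, rfl⟩⟩
end

section
/- Functional instance reducibility is a Heyting prealgebra: define, for pairs (A, P) and (B, Q) with P : A → Prop and Q : B → Prop, the relation (A, P) ≤f (B, Q) to hold iff there exists f : A → B with ∀ a : A, Q (f a) → P a. Then ≤f is reflexive and transitive; (PUnit, fun _ => False) is a top element and (Empty, fun e => False) is a bottom element; ((A × B), fun (a,b) => P a ∨ Q b) is a binary meet of (A,P) and (B,Q) and ((A ⊕ B), Sum.elim P Q) is a binary join; and Heyting implication exists: for H := ({(k, K) : (A → B) × Prop // ∀ a, Q (k a) → P a ∨ K}, fun (k,K) => ∃ a, Q (k a) ∧ K), one has for all (C,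 R): ((C × A), fun (c,a) => R c ∨ P a) ≤f (B, Q) if and only if (C, R) ≤f H. -/
/-- Functional instance reducibility: `(A, P) ≤f (B, Q)` iff there is a map `f : A → B`
such that `Q (f a)` implies `P a` for all `a`. -/
def leF (A : Type) (P : A → Prop) (B : Type) (Q : B → Prop) : Prop :=
  ∃ f : A → B, ∀ a : A, Q (f a) → P a

/-- Functional instance reducibility is a Heyting prealgebra: it is a preorder with a top
and a bottom element, binary meets and joins, and Heyting implication. -/
theorem functional_instance_reducibility_heyting_prealgebra :
    -- reflexivity
    (∀ (A : Type) (P : A → Prop), leF A P A P) ∧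
    -- transitivity
    (∀ (A : Type) (P : A → Prop) (B : Type) (Q : B → Prop) (C : Type) (R : C → Prop),
      leF A P B Q → leF B Q C R → leF A P C R) ∧
    -- top element
    (∀ (A : Type) (P : A → Prop), leF A P PUnit (fun _ => False)) ∧
    -- bottom element
    (∀ (A : Type) (P : A → Prop), leF Empty (fun _ => False) A P) ∧
    -- binary meets
    (∀ (A : Type) (P : A → Prop) (B : Type) (Q : B → Prop),
      leF (A × B) (fun z => P z.1 ∨ Q z.2) A P ∧
      leF (A × B) (fun z => P z.1 ∨ Q z.2) B Q ∧
      (∀ (C : Type) (R : C → Prop),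
        leF C R A P → leF C R B Q → leF C R (A × B) (fun z => P z.1 ∨ Q z.2))) ∧
    -- binary joins
    (∀ (A : Type) (P : A → Prop) (B : Type) (Q : B → Prop),
      leF A P (A ⊕ B) (Sum.elim P Q) ∧
      leF B Q (A ⊕ B) (Sum.elim P Q) ∧
      (∀ (C : Type) (R : C → Prop),
        leF A P C R → leF B Q C R → leF (A ⊕ B) (Sum.elim P Q) C R)) ∧
    -- Heyting implication
    (∀ (A : Type) (P : A → Prop) (B : Type) (Q : B → Prop) (C : Type) (R : C → Prop),
      leF (C × A) (fun z => R z.1 ∨ P z.2) B Q ↔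
      leF C R {kK : (A → B) × Prop // ∀ a, Q (kK.1 a) → P a ∨ kK.2}
        (fun kK => ∃ a, Q (kK.val.1 a) ∧ kK.val.2)) := by
  refine ⟨fun A P => ⟨id, fun _ h => h⟩, ?_, fun A P => ⟨fun _ => PUnit.unit, fun _ h => h.elim⟩,
    fun A P => ⟨Empty.elim, fun e => e.elim⟩, fun A P B Q => ⟨?_, ?_, ?_⟩,
    fun A P B Q => ⟨⟨Sum.inl, fun _ h => h⟩, ⟨Sum.inr, fun _ h => h⟩, ?_⟩,
    fun A P B Q C R => ⟨?_, ?_⟩⟩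
  · rintro A P B Q C R ⟨f, hf⟩ ⟨g, hg⟩
    exact ⟨g ∘ f, fun a h => hf a (hg (f a) h)⟩
  · exact ⟨Prod.fst, fun _ h => Or.inl h⟩
  · exact ⟨Prod.snd, fun _ h => Or.inr h⟩
  · rintro C R ⟨f, hf⟩ ⟨g, hg⟩
    exact ⟨fun c => (f c, g c), fun c h => h.elim (hf c) (hg c)⟩
  · rintro C R ⟨f, hf⟩ ⟨g, hg⟩
    exact ⟨Sum.elim f g, Sum.rec hf hg⟩
  · rintro ⟨f, hf⟩
    exact ⟨fun c => ⟨(fun a => f (c, a), R c), fun a h => (hf (c, a) h).symm⟩,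
      fun _ ⟨_, _, h⟩ => h⟩
  · rintro ⟨g, hg⟩
    exact ⟨fun z => (g z.1).val.1 z.2, fun z h =>
      ((g z.1).property z.2 h).elim Or.inr fun hK => Or.inl (hg z.1 ⟨z.2, h, hK⟩)⟩
end

section
/- Instance reducibility is the preorder reflection of the Kleisli category of the inhabited-powerset monad on propositional containers: for types A, B with P : A → Prop and Q : B → Prop, one has (∀ b : B, ∃ a : A, (P a → Q b)) if and only if there exists u : B → {v : A → Prop // ∃ x : A, v x} such that ∀ b : B, (∃ a : A, (u b).val a ∧ P a) → Q b; that is, (A ◁ᵖ P) ≤I (B ◁ᵖ Q) holds exactly when there exists a PCont morphism from B ◁ᵖ Q to 𝒫₊ᶜ(A ◁ᵖ P). -/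
/-- Instance reducibility is the preorder reflection of the Kleisli category of the
inhabited-powerset monad on propositional containers: `(A ◁ᵖ P) ≤I (B ◁ᵖ Q)` holds
exactly when there is a morphism of propositional containers from `B ◁ᵖ Q` to
`𝒫₊ᶜ(A ◁ᵖ P)`. -/
theorem instance_reducibility_iff_kleisli_morphism
    (A : Type) (P : A → Prop) (B : Type) (Q : B → Prop) :
    (∀ b : B, ∃ a : A, (P a → Q b)) ↔
    ∃ u : B → {v : A → Prop // ∃ x : A, v x},
      ∀ b : B, (∃ a : A, (u b).val a ∧ P a) → Q b := by
  constructor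
  · intro h
    exact ⟨fun b => ⟨fun a => P a → Q b, h b⟩, fun _ ⟨_, hPQ, hP⟩ => hPQ hP⟩
  · rintro ⟨u, hu⟩ b
    obtain ⟨a, ha⟩ := (u b).property
    exact ⟨a, fun hP => hu b ⟨a, ha, hP⟩⟩
end
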